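/- Let L be a domain and let E be a second-countable topological space. Every L-valued weakly outer-continuous σ-maxitive measure on the Borel σ-algebra ℬ of E is regular. -/

import Mathlib

open Set

universe u v

section OrderDefs
variable {L : Type u} [PartialOrder L]

/-- A filtered (nonempty, downward directed) subset of a poset. -/
def DirFiltered (F : Set L) : Prop :=
  F.Nonempty ∧ ∀ r ∈ F, ∀ s ∈ F, ∃ t ∈ F, t ≤ r ∧ t ≤ s

/-- A filter of a poset: a filtered upper set. -/
def OrdFilter (F : Set L) : Prop :=
  DirFiltered F ∧ ∀ r ∈ F, ∀ s : L, r ≤ s → s ∈ F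

/-- Every filter has an infimum. -/
def FilteredComplete (L : Type u) [PartialOrder L] : Prop :=
  ∀ F : Set L, OrdFilter F → ∃ i : L, IsGLB F i

/-- `s` is way-above `r`: for every filter `F` with an infimum below `r`, `s ∈ F`. -/
def WayAbove (s r : L) : Prop :=
  ∀ F : Set L, OrdFilter F → ∀ i : L, IsGLB F i → i ≤ r → s ∈ F

/-- The poset is continuous: for every `r`, the set of elements way-above `r`
is a filter whose infimum is `r`. -/
def ContinuousPoset (L : Type u) [PartialOrder L] : Prop :=
  ∀ r : L, OrdFilter {s : L | WayAbove s r} ∧ IsGLB {s : L | WayAbove s r} r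

/-- Conditional completeness: every nonempty set bounded above has a supremum. -/
def CondComplete (L : Type u) [PartialOrder L] : Prop :=
  ∀ S : Set L, S.Nonempty → BddAbove S → ∃ m : L, IsLUB S m

end OrderDefs

/-- A domain: a filtered-complete continuous poset with a least element. -/
def DomainPoset (L : Type u) [PartialOrder L] [OrderBot L] : Prop :=
  FilteredComplete L ∧ ContinuousPoset L

section TopDefs
variable {E : Type v} [TopologicalSpace E]

/-- The saturation of a set: intersection of all open sets containing it. -/
def satur (A : Set E) : Set E := ⋂₀ {G : Set E | IsOpen G ∧ A ⊆ G}

/-- A set is saturated if it is an intersection of open sets. -/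
def IsSatur (A : Set E) : Prop :=
  ∃ 𝒢 : Set (Set E), (∀ G ∈ 𝒢, IsOpen G) ∧ A = ⋂₀ 𝒢

/-- The collection 𝒬 of compact saturated subsets. -/
def CompactSat (E : Type v) [TopologicalSpace E] : Set (Set E) :=
  {A : Set E | IsCompact A ∧ IsSatur A}

/-- The Borel σ-algebra generated by open sets and compact saturated sets. -/
def BorelM (E : Type v) [TopologicalSpace E] : MeasurableSpace E :=
  MeasurableSpace.generateFrom ({A : Set E | IsOpen A} ∪ CompactSat E)

/-- Borel subsets for the σ-algebra generated by opens and compact saturated sets. -/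
def IsBorelSet (B : Set E) : Prop := @MeasurableSet E (BorelM E) B

/-- The collection 𝒦 of compact Borel subsets. -/
def CompactBorel (E : Type v) [TopologicalSpace E] : Set (Set E) :=
  {A : Set E | IsBorelSet A ∧ IsCompact A}

/-- `[x]` : the compact Borel set `↑{x} ∩ closure {x}`. -/
def ptClass (x : E) : Set E := satur {x} ∩ closure {x}

end TopDefs

section MeasDefs
variable {L : Type u} {E : Type v} [PartialOrder L] [OrderBot L] [TopologicalSpace E]

/-- An L-valued maxitive measure on the Borel σ-algebra. -/
def Maxitive (ν : Set E → L) : Prop :=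
  ν ∅ = ⊥ ∧ ∀ 𝒞 : Set (Set E), 𝒞.Finite → (∀ B ∈ 𝒞, IsBorelSet B) →
    IsLUB (ν '' 𝒞) (ν (⋃₀ 𝒞))

/-- σ-maxitivity. -/
def SigmaMaxitive (ν : Set E → L) : Prop :=
  Maxitive ν ∧ ∀ 𝒞 : Set (Set E), 𝒞.Countable → (∀ B ∈ 𝒞, IsBorelSet B) →
    IsLUB (ν '' 𝒞) (ν (⋃₀ 𝒞))

/-- Complete maxitivity. -/
def CompletelyMaxitive (ν : Set E → L) : Prop :=
  Maxitive ν ∧ ∀ 𝒞 : Set (Set E), (∀ B ∈ 𝒞, IsBorelSet B) → IsBorelSet (⋃₀ 𝒞) →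
    IsLUB (ν '' 𝒞) (ν (⋃₀ 𝒞))

/-- The set `{ν G : G open, G ⊇ B}`. -/
def outerVals (ν : Set E → L) (B : Set E) : Set L :=
  {l : L | ∃ G : Set E, IsOpen G ∧ B ⊆ G ∧ ν G = l}

/-- `νp` is the map `ν⁺ : B ↦ inf {ν G : G open, G ⊇ B}` on Borel sets. -/
def IsNuPlus (ν νp : Set E → L) : Prop :=
  ∀ B : Set E, IsBorelSet B → IsGLB (outerVals ν B) (νp B)

/-- Outer-continuity. -/
def OuterContinuous (ν : Set E → L) : Prop :=
  ∀ B : Set E, IsBorelSet B → IsGLB (outerVals ν B) (ν B)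

/-- Inner-continuity. -/
def InnerContinuous (ν : Set E → L) : Prop :=
  ∀ B : Set E, IsBorelSet B →
    IsLUB {l : L | ∃ K : Set E, IsBorelSet K ∧ IsCompact K ∧ K ⊆ B ∧ ν (satur K) = l} (ν B)

/-- Regularity: inner- and outer-continuity. -/
def RegularMeasure (ν : Set E → L) : Prop :=
  InnerContinuous ν ∧ OuterContinuous ν

/-- Weak outer-continuity: `ν K = ν⁺ K` for every compact Borel `K`. -/
def WeaklyOuterContinuous (ν : Set E → L) : Prop :=
  ∀ K : Set E, IsBorelSet K → IsCompact K → IsGLB (outerVals ν K) (ν K)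

/-- Weak inner-continuity (relative to a given `ν⁺ = νp`). -/
def WeaklyInnerContinuous (ν νp : Set E → L) : Prop :=
  ∀ G : Set E, IsOpen G →
    IsLUB {l : L | ∃ K : Set E, IsBorelSet K ∧ IsCompact K ∧ K ⊆ G ∧ νp K = l} (ν G)

/-- 𝒜-smoothness. -/
def SmoothWrt (ν : Set E → L) (𝒜 : Set (Set E)) : Prop :=
  ∀ 𝒟 : Set (Set E), 𝒟.Nonempty → 𝒟 ⊆ 𝒜 → DirectedOn (· ⊇ ·) 𝒟 →
    IsGLB (ν '' 𝒟) (ν (⋂₀ 𝒟))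

/-- Saturation of a maxitive measure: `ν K = ν (↑K)` for compact Borel `K`. -/
def SaturatedMeasure (ν : Set E → L) : Prop :=
  ∀ K : Set E, IsBorelSet K → IsCompact K → ν K = ν (satur K)

/-- Tightness: `inf {ν (E ∖ K) : K compact Borel} = 0`. -/
def TightMeasure (ν : Set E → L) : Prop :=
  IsGLB {l : L | ∃ K : Set E, IsBorelSet K ∧ IsCompact K ∧ ν Kᶜ = l} (⊥ : L)

/-- `c` is a cardinal density of `ν`. -/
def IsCardinalDensity (ν : Set E → L) (c : E → L) : Prop :=
  ∀ B : Set E, IsBorelSet B → IsLUB (c '' B) (ν B)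

/-- Upper semicontinuity of a map into the poset. -/
def UscMap (c : E → L) : Prop := ∀ t : L, IsOpen {x : E | WayAbove t (c x)}

/-- Upper compactness of a map into the poset. -/
def UpperCompactMap (c : E → L) : Prop :=
  ∀ t : L, WayAbove t (⊥ : L) → IsCompact {x : E | ¬ WayAbove t (c x)}

/-- Continuity from above along decreasing sequences of Borel sets. -/
def ContinuousFromAbove (ν : Set E → L) : Prop :=
  ∀ B : ℕ → Set E, (∀ n, IsBorelSet (B n)) → (∀ n, B (n + 1) ⊆ B n) →
    IsGLB (Set.range fun n => ν (B n)) (ν (⋂ n, B n))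

/-- An optimal measure: a σ-maxitive measure continuous from above. -/
def OptimalMeasure (ν : Set E → L) : Prop :=
  SigmaMaxitive ν ∧ ContinuousFromAbove ν

/-- `flo` is the regular part `⌊ν⌋` (relative to `νp = ν⁺`):
`⌊ν⌋(B) = sup {ν⁺(K) : K compact Borel, K ⊆ B}`. -/
def RegPartRel (νp flo : Set E → L) : Prop :=
  ∀ B : Set E, IsBorelSet B →
    IsLUB {l : L | ∃ K : Set E, IsBorelSet K ∧ IsCompact K ∧ K ⊆ B ∧ νp K = l} (flo B)

end MeasDefs

section TopLemmas
variable {E : Type v} [TopologicalSpace E]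

lemma subset_satur (A : Set E) : A ⊆ satur A :=
  subset_sInter fun _ hG => hG.2

lemma satur_subset_of_isOpen {A G : Set E} (hG : IsOpen G) (h : A ⊆ G) : satur A ⊆ G :=
  sInter_subset_of_mem ⟨hG, h⟩

lemma isSatur_satur (A : Set E) : IsSatur (satur A) :=
  ⟨_, fun _ hG => hG.1, rfl⟩

lemma IsCompact.satur {K : Set E} (hK : IsCompact K) : IsCompact (satur K) := by
  refine isCompact_of_finite_subcover fun U hU hKU => ?_
  obtain ⟨t, ht⟩ := hK.elim_finite_subcover U hU ((subset_satur K).trans hKU)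
  exact ⟨t, satur_subset_of_isOpen (isOpen_biUnion fun i _ => hU i) ht⟩

lemma IsOpen.isBorelSet {G : Set E} (hG : IsOpen G) : IsBorelSet G :=
  MeasurableSpace.measurableSet_generateFrom (Or.inl hG)

lemma IsCompact.isBorelSet_satur {K : Set E} (hK : IsCompact K) : IsBorelSet (_root_.satur K) :=
  MeasurableSpace.measurableSet_generateFrom (Or.inr ⟨hK.satur, isSatur_satur K⟩)

lemma mem_ptClass_iff {x y : E} : y ∈ ptClass x ↔ Inseparable x y := by
  rw [inseparable_iff_forall_isOpen]
  constructor
  · rintro ⟨h₁, h₂⟩ G hG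
    refine ⟨fun hx => satur_subset_of_isOpen hG (singleton_subset_iff.2 hx) h₁, fun hy => ?_⟩
    obtain ⟨z, hz, rfl⟩ := mem_closure_iff.1 h₂ G hG hy
    exact hz
  · intro h
    refine ⟨fun G hG => (h G hG.1).1 (hG.2 rfl), mem_closure_iff.2 fun G hG hy => ?_⟩
    exact ⟨x, (h G hG).2 hy, rfl⟩

lemma self_mem_ptClass (x : E) : x ∈ ptClass x :=
  mem_ptClass_iff.2 (Inseparable.refl x)

lemma ptClass_subset_of_isOpen {x : E} {G : Set E} (hG : IsOpen G) (hx : x ∈ G) :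
    ptClass x ⊆ G :=
  inter_subset_left.trans (satur_subset_of_isOpen hG (singleton_subset_iff.2 hx))

lemma isCompact_ptClass (x : E) : IsCompact (ptClass x) :=
  isCompact_singleton.satur.inter_right isClosed_closure

lemma isBorelSet_ptClass (x : E) : IsBorelSet (ptClass x) := by
  have h : IsBorelSet (closure {x} : Set E)ᶜ := isClosed_closure.isOpen_compl.isBorelSet
  exact @MeasurableSet.inter E (BorelM E) _ _ isCompact_singleton.isBorelSet_satur
    ((@MeasurableSet.compl_iff E _ (BorelM E)).1 h)

/-- Borel sets do not separate topologically indistinguishable points. -/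
lemma IsBorelSet.mem_iff_of_inseparable {B : Set E} (hB : IsBorelSet B) {x y : E}
    (h : Inseparable x y) : x ∈ B ↔ y ∈ B := by
  have hopen := inseparable_iff_forall_isOpen.1 h
  induction B, hB using MeasurableSpace.generateFrom_induction with
  | hC t ht _ =>
    rcases ht with ht | ⟨-, 𝒢, h𝒢, rfl⟩
    · exact hopen t ht
    · exact forall₂_congr fun G hG => hopen G (h𝒢 G hG)
  | empty => exact Iff.rfl
  | compl t _ ih => exact not_congr ih
  | iUnion s _ ih => simp only [mem_iUnion, ih]

lemma IsBorelSet.ptClass_subset {B : Set E} (hB : IsBorelSet B) {x : E} (hx : x ∈ B) :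
    ptClass x ⊆ B :=
  fun _ hy => (hB.mem_iff_of_inseparable (mem_ptClass_iff.1 hy)).1 hx

end TopLemmas

section OrderLemmas
variable {L : Type u} [PartialOrder L]

lemma WayAbove.mono {s r r' : L} (h : WayAbove s r) (hr : r' ≤ r) : WayAbove s r' :=
  fun F hF i hi hir => h F hF i hi (hir.trans hr)

/-- It suffices to test the way-above relation against filtered sets. -/
lemma WayAbove.exists_le_of_dirFiltered {s r : L} (h : WayAbove s r) {F : Set L}
    (hF : DirFiltered F) (hr : IsGLB F r) : ∃ t ∈ F, t ≤ s := by
  have hfilter : OrdFilter (upperClosure F : Set L) := by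
    refine ⟨⟨hF.1.mono subset_upperClosure, ?_⟩, fun a ha b hab => (upperClosure F).upper hab ha⟩
    rintro a ⟨a', ha', haa⟩ b ⟨b', hb', hbb⟩
    obtain ⟨t, ht, hta, htb⟩ := hF.2 a' ha' b' hb'
    exact ⟨t, subset_upperClosure ht, hta.trans haa, htb.trans hbb⟩
  have hglb : IsGLB (upperClosure F : Set L) r := by
    rwa [IsGLB, lowerBounds_upperClosure]
  exact h _ hfilter r hglb le_rfl

end OrderLemmas

section MeasLemmas
variable {L : Type u} {E : Type v} [PartialOrder L] [OrderBot L] [TopologicalSpace E] {ν : Set E → L}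

lemma Maxitive.mono (hν : Maxitive ν) {A B : Set E} (hA : IsBorelSet A) (hB : IsBorelSet B)
    (h : A ⊆ B) : ν A ≤ ν B := by
  have hlub := hν.2 {A, B} (by simp) (by rintro C (rfl | rfl) <;> assumption)
  rw [sUnion_pair, union_eq_self_of_subset_left h] at hlub
  exact hlub.1 ⟨A, by simp, rfl⟩

lemma Maxitive.dirFiltered_outerVals (hν : Maxitive ν) (B : Set E) :
    DirFiltered (outerVals ν B) := by
  refine ⟨⟨_, univ, isOpen_univ, subset_univ B, rfl⟩, ?_⟩
  rintro _ ⟨G, hG, hBG, rfl⟩ _ ⟨H, hH, hBH, rfl⟩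
  have hGH := hG.inter hH
  exact ⟨_, ⟨G ∩ H, hGH, subset_inter hBG hBH, rfl⟩,
    hν.mono hGH.isBorelSet hG.isBorelSet inter_subset_left,
    hν.mono hGH.isBorelSet hH.isBorelSet inter_subset_right⟩

lemma WeaklyOuterContinuous.map_satur_le (hwoc : WeaklyOuterContinuous ν) (hν : Maxitive ν)
    {K : Set E} (hK : IsBorelSet K) (hKc : IsCompact K) : ν (satur K) ≤ ν K := by
  refine (hwoc K hK hKc).2 ?_
  rintro _ ⟨G, hG, hKG, rfl⟩
  exact hν.mono hKc.isBorelSet_satur hG.isBorelSet (satur_subset_of_isOpen hG hKG)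

/-- A set on which the values `ν [x]` are bounded by `u` has open neighbourhoods of measure at most
`s`, for every `s` way-above `u`. -/
lemma SigmaMaxitive.exists_isOpen_map_le [SecondCountableTopology E] (hν : SigmaMaxitive ν)
    (hwoc : WeaklyOuterContinuous ν) {B : Set E} {u s : L} (hu : ∀ x ∈ B, ν (ptClass x) ≤ u)
    (hs : WayAbove s u) : ∃ G, IsOpen G ∧ B ⊆ G ∧ ν G ≤ s := by
  obtain ⟨T, hTc, hTS, hT⟩ :=
    TopologicalSpace.isOpen_sUnion_countable {G : Set E | IsOpen G ∧ ν G ≤ s} fun _ h => h.1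
  refine ⟨⋃₀ T, isOpen_sUnion fun G hG => (hTS hG).1, fun x hx => ?_, ?_⟩
  · obtain ⟨_, ⟨G, hG, hxG, rfl⟩, hGs⟩ := (hs.mono (hu x hx)).exists_le_of_dirFiltered
      (hν.1.dirFiltered_outerVals _) (hwoc _ (isBorelSet_ptClass x) (isCompact_ptClass x))
    rw [hT]
    exact ⟨G, ⟨hG, hGs⟩, hxG (self_mem_ptClass x)⟩
  · refine (hν.2 T hTc fun G hG => (hTS hG).1.isBorelSet).2 ?_
    rintro _ ⟨G, hG, rfl⟩
    exact (hTS hG).2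

/-- The map `x ↦ ν [x]` is a cardinal density of `ν`. -/
lemma SigmaMaxitive.isCardinalDensity_ptClass [SecondCountableTopology E] (hL : ContinuousPoset L)
    (hν : SigmaMaxitive ν) (hwoc : WeaklyOuterContinuous ν) :
    IsCardinalDensity ν fun x => ν (ptClass x) := by
  intro B hB
  constructor
  · rintro _ ⟨x, hx, rfl⟩
    exact hν.1.mono (isBorelSet_ptClass x) hB (hB.ptClass_subset hx)
  · intro u hu
    refine (hL u).2.2 fun s hs => ?_
    obtain ⟨G, hG, hBG, hGs⟩ :=
      hν.exists_isOpen_map_le hwoc (fun x hx => hu ⟨x, hx, rfl⟩) hs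
    exact (hν.1.mono hB hG.isBorelSet hBG).trans hGs

end MeasLemmas

/-- on a second-countable space, every weakly outer-continuous
σ-maxitive measure is regular. -/
theorem stmt14 {L : Type u} {E : Type v} [PartialOrder L] [OrderBot L]
    [TopologicalSpace E] [SecondCountableTopology E] (hL : DomainPoset L)
    (ν : Set E → L) (hν : SigmaMaxitive ν) (hwoc : WeaklyOuterContinuous ν) :
    RegularMeasure ν := by
  have hdens := hν.isCardinalDensity_ptClass hL.2 hwoc
  refine ⟨fun B hB => ⟨?_, fun u hu => (hdens B hB).2 ?_⟩, fun B hB => ⟨?_, fun l hl => ?_⟩⟩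
  · rintro _ ⟨K, hK, hKc, hKB, rfl⟩
    exact (hwoc.map_satur_le hν.1 hK hKc).trans (hν.1.mono hK hB hKB)
  · rintro _ ⟨x, hx, rfl⟩
    have hc := isCompact_ptClass x
    have hb := isBorelSet_ptClass x
    exact (hν.1.mono hb hc.isBorelSet_satur (subset_satur _)).trans
      (hu ⟨_, hb, hc, hB.ptClass_subset hx, rfl⟩)
  · rintro _ ⟨G, hG, hBG, rfl⟩
    exact hν.1.mono hB hG.isBorelSet hBG
  · refine (hL.2 (ν B)).2.2 fun s hs => ?_
    obtain ⟨G, hG, hBG, hGs⟩ :=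
      hν.exists_isOpen_map_le hwoc (fun x hx => (hdens B hB).1 ⟨x, hx, rfl⟩) hs
    exact (hl ⟨G, hG, hBG, rfl⟩).trans hGs
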